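/- arXiv:1809.01469 — 2 statements merged into one kernel-verified Lean document; each statement's English description precedes it below -/
import Mathlib

section
/- Fix integers d ≥ 1 and k ≥ 1. Every full-rank lattice Γ ⊂ ℝ^d with covolume |Γ| = 1 that maximises Λ̃_{2k} (i.e. Λ̃_{2k}(Γ) ≥ Λ̃_{2k}(Γ′) for every full-rank lattice Γ′ ⊂ ℝ^d) satisfies μ_1(Γ) ≥ k^{−1 + 1/d}. -/
open scoped RealInnerProductSpace
open MeasureTheory

noncomputable section

/-- The full-rank lattice `A ℤ^d ⊂ ℝ^d` (Euclidean space), for `A ∈ GL_d(ℝ)`. -/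
def lat (d : ℕ) (A : Matrix (Fin d) (Fin d) ℝ) : Set (EuclideanSpace ℝ (Fin d)) :=
  {x | ∃ n : Fin d → ℤ, ∀ i, x i = ∑ j, A i j * (n j : ℝ)}

/-- `|γ_k(Γ)|`, the norm of the `k`-th lattice point when points are ordered by
non-decreasing norm (with `γ_0 = 0`):
`min {r ≥ 0 : #{γ ∈ Γ : ‖γ‖ ≤ r} ≥ k + 1}`. -/
def gammaNorm (d : ℕ) (A : Matrix (Fin d) (Fin d) ℝ) (k : ℕ) : ℝ :=
  sInf {r : ℝ | 0 ≤ r ∧ k + 1 ≤ ({γ ∈ lat d A | ‖γ‖ ≤ r}).ncard}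

/-- The scale-invariant functional `Λ̃_k(Γ) = |Γ|^{-1/d} |γ_k(Γ)|`, where the covolume
of the lattice `A ℤ^d` is `|det A|`. -/
def Lam (d : ℕ) (A : Matrix (Fin d) (Fin d) ℝ) (k : ℕ) : ℝ :=
  |A.det| ^ (-(1 : ℝ) / d) * gammaNorm d A k

/-- The `j`-th successive minimum of the lattice `A ℤ^d`:
`μ_j(Γ) = inf {μ > 0 : the points of Γ of norm ≤ μ span a subspace of dimension ≥ j}`. -/
def mu (d : ℕ) (A : Matrix (Fin d) (Fin d) ℝ) (j : ℕ) : ℝ :=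
  sInf {μ : ℝ | 0 < μ ∧
    j ≤ Module.finrank ℝ (Submodule.span ℝ {γ ∈ lat d A | ‖γ‖ ≤ μ})}

lemma lat_fin (d : ℕ) (A : Matrix (Fin d) (Fin d) ℝ) (hA : A.det ≠ 0) (r : ℝ) :
    ({γ ∈ lat d A | ‖γ‖ ≤ r}).Finite := by
  classical
  set C : ℝ := ∑ j, ∑ i, |A⁻¹ j i| * r with hC
  set M : ℤ := ⌈C⌉
  have hbox : (Set.Icc (fun _ : Fin d => -M) (fun _ => M)).Finite := Set.finite_Icc _ _
  refine (hbox.image (fun n : Fin d → ℤ =>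
    (WithLp.toLp 2 (fun i => ∑ j, A i j * (n j : ℝ)) : EuclideanSpace ℝ (Fin d)))).subset ?_
  rintro x ⟨⟨n, hn⟩, hx⟩
  have hr : 0 ≤ r := (norm_nonneg x).trans hx
  refine ⟨n, ?_, ?_⟩
  · have key : ∀ j, |(n j : ℝ)| ≤ C := by
      intro j
      have h1 : A.mulVec (fun j => (n j : ℝ)) = fun i => x i := by
        funext i
        rw [hn i]; rfl
      have h2 : (fun j => (n j : ℝ)) = A⁻¹.mulVec (fun i => x i) := by
        rw [← h1, Matrix.mulVec_mulVec, Matrix.nonsing_inv_mul _ (isUnit_iff_ne_zero.mpr hA),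
          Matrix.one_mulVec]
      have h3 : (n j : ℝ) = ∑ i, A⁻¹ j i * x i := congrFun h2 j
      have h4 : |(n j : ℝ)| ≤ ∑ i, |A⁻¹ j i| * r := by
        rw [h3]
        refine (Finset.abs_sum_le_sum_abs _ _).trans (Finset.sum_le_sum fun i _ => ?_)
        rw [abs_mul]
        refine mul_le_mul_of_nonneg_left ?_ (abs_nonneg _)
        have := PiLp.norm_apply_le x i
        rw [Real.norm_eq_abs] at this
        exact this.trans hx
      refine h4.trans ?_
      exact Finset.single_le_sum (f := fun j => ∑ i, |A⁻¹ j i| * r)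
        (fun j _ => Finset.sum_nonneg fun i _ => mul_nonneg (abs_nonneg _) hr) (Finset.mem_univ j)
    rw [Set.mem_Icc]
    constructor
    · intro j
      have := (abs_le.mp (key j)).1
      have h5 : C ≤ (M : ℝ) := Int.le_ceil C
      have : ((-M : ℤ) : ℝ) ≤ n j := by push_cast; linarith
      exact_mod_cast this
    · intro j
      have := (abs_le.mp (key j)).2
      have h5 : C ≤ (M : ℝ) := Int.le_ceil C
      have : (n j : ℝ) ≤ (M : ℝ) := by linarith
      exact_mod_cast this
  · ext i
    simp [hn i]

lemma smul_mem_lat {d : ℕ} {A : Matrix (Fin d) (Fin d) ℝ} {x : EuclideanSpace ℝ (Fin d)}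
    (hx : x ∈ lat d A) (z : ℤ) : (z : ℝ) • x ∈ lat d A := by
  obtain ⟨n, hn⟩ := hx
  refine ⟨fun j => z * n j, fun i => ?_⟩
  simp only [PiLp.smul_apply, smul_eq_mul, hn i, Finset.mul_sum]
  refine Finset.sum_congr rfl fun j _ => ?_
  push_cast; ring

/-- multiples of a nonzero lattice point -/
lemma mem_set (d k : ℕ) (A : Matrix (Fin d) (Fin d) ℝ) (hA : A.det ≠ 0)
    (x : EuclideanSpace ℝ (Fin d)) (hx : x ∈ lat d A) (hx0 : x ≠ 0) :
    ((k : ℝ) * ‖x‖) ∈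
      {r : ℝ | 0 ≤ r ∧ 2 * k + 1 ≤ ({γ ∈ lat d A | ‖γ‖ ≤ r}).ncard} := by
  refine ⟨by positivity, ?_⟩
  have hinj : Function.Injective (fun z : ℤ => (z : ℝ) • x) := by
    intro a b hab
    have := smul_left_injective ℝ hx0 hab
    exact_mod_cast this
  have hsub : (fun z : ℤ => (z : ℝ) • x) '' (Set.Icc (-(k : ℤ)) k) ⊆
      {γ ∈ lat d A | ‖γ‖ ≤ (k : ℝ) * ‖x‖} := by
    rintro _ ⟨z, hz, rfl⟩
    refine ⟨smul_mem_lat hx z, ?_⟩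
    simp only [norm_smul, Real.norm_eq_abs]
    refine mul_le_mul_of_nonneg_right ?_ (norm_nonneg _)
    have : |z| ≤ (k : ℤ) := abs_le.mpr hz
    exact_mod_cast this
  have := Set.ncard_le_ncard hsub (lat_fin d A hA _)
  rw [Set.ncard_image_of_injective _ hinj, ← Finset.coe_Icc, Set.ncard_coe_finset,
    Int.card_Icc] at this
  omega

lemma gamma_le (d k : ℕ) (A : Matrix (Fin d) (Fin d) ℝ) (hA : A.det ≠ 0)
    (x : EuclideanSpace ℝ (Fin d)) (hx : x ∈ lat d A) (hx0 : x ≠ 0) :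
    gammaNorm d A (2 * k) ≤ k * ‖x‖ :=
  csInf_le ⟨0, fun _ h => h.1⟩ (mem_set d k A hA x hx hx0)

lemma exists_lat_nonzero (m : ℕ) (A : Matrix (Fin (m+1)) (Fin (m+1)) ℝ) (hA : A.det ≠ 0) :
    ∃ x ∈ lat (m+1) A, x ≠ 0 := by
  refine ⟨WithLp.toLp 2 (fun i => A i 0), ⟨fun j => if j = 0 then 1 else 0, fun i => ?_⟩, ?_⟩
  · simp
  · intro h
    apply hA
    refine Matrix.det_eq_zero_of_column_eq_zero 0 fun i => ?_
    have := congrArg (fun y : EuclideanSpace ℝ (Fin (m+1)) => y i) h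
    simpa using this

/-- test lattice -/
def testB (m k : ℕ) : Matrix (Fin (m+1)) (Fin (m+1)) ℝ :=
  Matrix.diagonal (fun i => if i = 0 then (k : ℝ)⁻¹ else 1)

lemma testB_det (m k : ℕ) : (testB m k).det = (k : ℝ)⁻¹ := by
  rw [testB, Matrix.det_diagonal, Finset.prod_ite_eq' Finset.univ 0 (fun _ => (k : ℝ)⁻¹)]
  simp

lemma testB_gamma (m k : ℕ) (hk : 1 ≤ k) : 1 ≤ gammaNorm (m+1) (testB m k) (2 * k) := by
  have hk0 : (0 : ℝ) < k := by exact_mod_cast hk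
  have hdet : (testB m k).det ≠ 0 := by rw [testB_det]; positivity
  obtain ⟨x, hx, hx0⟩ := exists_lat_nonzero m _ hdet
  refine le_csInf ⟨_, mem_set _ k _ hdet x hx hx0⟩ ?_
  rintro r ⟨hr0, hr⟩
  by_contra! hr1
  have hsub : {γ ∈ lat (m+1) (testB m k) | ‖γ‖ ≤ r} ⊆
      (fun z : ℤ => (WithLp.toLp 2 (fun i => if i = 0 then (k : ℝ)⁻¹ * z else 0) :
        EuclideanSpace ℝ (Fin (m+1)))) '' (Set.Ioo (-(k : ℤ)) k) := by
    rintro y ⟨⟨n, hn⟩, hy⟩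
    have hn' : ∀ i, y i = (if i = 0 then (k : ℝ)⁻¹ else 1) * n i := by
      intro i
      rw [hn i]
      simp [testB, Matrix.diagonal_apply]
    have hlt : ∀ i, |y i| < 1 := by
      intro i
      have := PiLp.norm_apply_le y i
      rw [Real.norm_eq_abs] at this
      linarith
    refine ⟨n 0, ?_, ?_⟩
    · have h := hlt 0
      rw [hn' 0, if_pos rfl, abs_mul, abs_of_pos (inv_pos.mpr hk0), inv_mul_lt_iff₀ hk0,
        mul_one] at h
      have h' : |n 0| < (k : ℤ) := by exact_mod_cast h
      exact abs_lt.mp h'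
    · ext i
      by_cases hi : i = 0
      · subst hi
        simp [hn' 0]
      · have h := hlt i
        rw [hn' i, if_neg hi, one_mul] at h
        have h' : |n i| < 1 := by
          rw [← Int.cast_abs] at h
          refine (Int.cast_lt (R := ℝ)).mp ?_
          rw [Int.cast_one]
          exact h
        have h0 : n i = 0 := Int.abs_lt_one_iff.mp h'
        simp [hn' i, hi, h0]
  have h1 := Set.ncard_le_ncard hsub ((Set.finite_Ioo _ _).image _)
  have h2 := Set.ncard_image_le (s := Set.Ioo (-(k : ℤ)) k) (Set.finite_Ioo _ _)
    (f := (fun z : ℤ => (WithLp.toLp 2 (fun i => if i = 0 then (k : ℝ)⁻¹ * z else 0) :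
        EuclideanSpace ℝ (Fin (m+1)))))
  rw [← Finset.coe_Ioo, Set.ncard_coe_finset, Int.card_Ioo] at h2
  rw [← Finset.coe_Ioo] at h1
  omega

/-- For `d ≥ 1`, `k ≥ 1`, every unit-covolume lattice maximising `Λ̃_{2k}`
satisfies `μ_1(Γ) ≥ k^{-1 + 1/d}`. -/
theorem stmt_2 (d k : ℕ) (hd : 1 ≤ d) (hk : 1 ≤ k)
    (A : Matrix (Fin d) (Fin d) ℝ) (hA : |A.det| = 1)
    (hmax : ∀ B : Matrix (Fin d) (Fin d) ℝ, B.det ≠ 0 → Lam d B (2 * k) ≤ Lam d A (2 * k)) :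
    (k : ℝ) ^ (-1 + (1 : ℝ) / d) ≤ mu d A 1 := by
  obtain ⟨m, rfl⟩ : ∃ m, d = m + 1 := ⟨d - 1, by omega⟩
  have hk0 : (0 : ℝ) < k := by exact_mod_cast hk
  have hdet : A.det ≠ 0 := by
    intro h
    simp [h] at hA
  have hB := hmax (testB m k) (by rw [testB_det]; positivity)
  have hg := testB_gamma m k hk
  have hlow : (k : ℝ) ^ ((1 : ℝ) / ((m + 1 : ℕ) : ℝ)) ≤ gammaNorm (m+1) A (2 * k) := by
    unfold Lam at hB
    rw [hA, Real.one_rpow, one_mul, testB_det, abs_of_pos (inv_pos.mpr hk0),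
      Real.inv_rpow hk0.le, ← Real.rpow_neg hk0.le, neg_div, neg_neg] at hB
    refine le_trans ?_ hB
    exact le_mul_of_one_le_right (by positivity) hg
  rw [Real.rpow_add hk0, Real.rpow_neg_one]
  have main : ∀ x ∈ lat (m+1) A, x ≠ 0 →
      (k : ℝ)⁻¹ * (k : ℝ) ^ ((1 : ℝ) / ((m + 1 : ℕ) : ℝ)) ≤ ‖x‖ := by
    intro x hx hx0
    rw [inv_mul_le_iff₀ hk0]
    exact hlow.trans (gamma_le _ k A hdet x hx hx0)
  refine le_csInf ?_ ?_
  · obtain ⟨x, hx, hx0⟩ := exists_lat_nonzero m A hdet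
    refine ⟨‖x‖, norm_pos_iff.mpr hx0, ?_⟩
    rw [Nat.one_le_iff_ne_zero]
    intro h
    rw [Submodule.finrank_eq_zero, Submodule.span_eq_bot] at h
    exact hx0 (h x ⟨hx, le_rfl⟩)
  · rintro μ ⟨hμ, h1⟩
    by_contra! hlt
    have : Submodule.span ℝ {γ ∈ lat (m+1) A | ‖γ‖ ≤ μ} = ⊥ := by
      rw [Submodule.span_eq_bot]
      rintro x ⟨hx, hxμ⟩
      by_contra hx0
      have := main x hx hx0
      linarith
    rw [this, finrank_bot] at h1
    omega
end
end

section
/- Let d be an integer with 2 ≤ d ≤ 10, and for each k ≥ 1 let Γ_k ⊂ ℝ^d be any full-rank lattice with covolume |Γ_k| = 1 maximising Λ̃_k (i.e. Λ̃_k(Γ_k) ≥ Λ̃_k(Γ′) for every full-rank lattice Γ′ ⊂ ℝ^d). Then μ_1(Γ_k) → 0 as k → ∞; in particular the sequence (Γ_k) has no accumulation point in the space of unit-covolume lattices (it eventually leaves every set of lattices on which μ_1 is bounded away from 0). -/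
open scoped RealInnerProductSpace
open MeasureTheory

noncomputable section

lemma vol_gt (d : ℕ) (hd2 : 2 ≤ d) (hd10 : d ≤ 10) (s : ℝ) (hs : 0 < s) :
    ENNReal.ofReal (5/2 * s^d) < volume (Metric.ball (0 : EuclideanSpace ℝ (Fin d)) s) := by
  have hpi := Real.pi_gt_d2
  have key : ∀ c : ℝ, 5/2 < c → ENNReal.ofReal (5/2 * s^d) < ENNReal.ofReal s ^ d * ENNReal.ofReal c := by
    intro c hc
    rw [← ENNReal.ofReal_pow hs.le, ← ENNReal.ofReal_mul (by positivity)]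
    have : 0 < s^d := by positivity
    apply (ENNReal.ofReal_lt_ofReal_iff (by positivity)).2
    nlinarith
  have p2 : (9:ℝ) < Real.pi^2 := by nlinarith
  have p2' : (9.85:ℝ) < Real.pi^2 := by nlinarith
  have p4 : (97:ℝ) < Real.pi^4 := by nlinarith
  have p3 : (30:ℝ) < Real.pi^3 := by nlinarith
  have p5 : (300:ℝ) < Real.pi^5 := by nlinarith
  have : Nonempty (Fin d) := ⟨⟨0, by omega⟩⟩
  have : Nontrivial (EuclideanSpace ℝ (Fin d)) := by
    apply Module.nontrivial_of_finrank_pos (R := ℝ); simp; omega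
  rcases Nat.even_or_odd' d with ⟨k, hk | hk⟩
  · rw [InnerProductSpace.volume_ball_of_dim_even (k := k) (by simpa using hk)]
    rw [finrank_euclideanSpace_fin]
    apply key
    have h1: 1 ≤ k := by omega
    have h2: k ≤ 5 := by omega
    clear hk key
    interval_cases k <;> norm_num [Nat.factorial] <;> linarith
  · rw [InnerProductSpace.volume_ball_of_dim_odd (k := k) (by simpa using hk)]
    rw [finrank_euclideanSpace_fin]
    apply key
    rw [hk]
    have h1: 1 ≤ k := by omega
    have h2: k ≤ 4 := by omega
    clear hk key
    interval_cases k <;> norm_num [Nat.factorial, Nat.doubleFactorial] <;> linarith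

/-- The lattice point with integer coordinates `n`. -/
def latPt {d : ℕ} (A : Matrix (Fin d) (Fin d) ℝ) (n : Fin d → ℤ) : EuclideanSpace ℝ (Fin d) :=
  WithLp.toLp 2 (A.mulVec (fun j => (n j : ℝ)))

lemma latPt_sub {d : ℕ} (A : Matrix (Fin d) (Fin d) ℝ) (n m : Fin d → ℤ) :
    latPt A (n - m) = latPt A n - latPt A m := by
  have : (fun j => (((n - m) j : ℤ) : ℝ)) = (fun j => (n j : ℝ)) - (fun j => (m j : ℝ)) := by
    ext j; simp
  rw [latPt, this, Matrix.mulVec_sub]; rfl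

lemma latPt_zero {d : ℕ} (A : Matrix (Fin d) (Fin d) ℝ) : latPt A 0 = 0 := by
  have := latPt_sub A 0 0
  simpa using this

lemma latPt_inj {d : ℕ} (A : Matrix (Fin d) (Fin d) ℝ) (hA : A.det ≠ 0) :
    Function.Injective (latPt A) := by
  intro n m h
  have h1 : A.mulVec (fun j => (n j : ℝ)) = A.mulVec (fun j => (m j : ℝ)) := by
    simpa [latPt] using h
  have hu : IsUnit A := (Matrix.isUnit_iff_isUnit_det A).2 (isUnit_iff_ne_zero.2 hA)
  have h2 := Matrix.mulVec_injective_of_isUnit hu h1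
  ext j
  have := congrFun h2 j
  exact_mod_cast this

lemma lat_eq {d : ℕ} (A : Matrix (Fin d) (Fin d) ℝ) : lat d A = Set.range (latPt A) := by
  ext x
  constructor
  · rintro ⟨n, hn⟩
    refine ⟨n, ?_⟩
    ext i
    simp [latPt, hn i, Matrix.mulVec, dotProduct]
  · rintro ⟨n, rfl⟩
    exact ⟨n, fun i => by simp [latPt, Matrix.mulVec, dotProduct]⟩

lemma lat_finite {d : ℕ} (A : Matrix (Fin d) (Fin d) ℝ) (hA : A.det ≠ 0) (r : ℝ) :
    {γ ∈ lat d A | ‖γ‖ ≤ r}.Finite := by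
  have hu : IsUnit A.det := isUnit_iff_ne_zero.2 hA
  let f : EuclideanSpace ℝ (Fin d) → (Fin d → ℝ) := fun x => A⁻¹.mulVec x.ofLp
  have hf : Continuous f := by
    apply Continuous.matrix_mulVec continuous_const
    exact PiLp.continuous_ofLp 2 _
  have hc : IsCompact (f '' Metric.closedBall 0 r) := (isCompact_closedBall _ _).image hf
  obtain ⟨C, hC⟩ := hc.isBounded.exists_norm_le
  have hfin : (Metric.closedBall (0 : Fin d → ℤ) C).Finite :=
    (isCompact_closedBall _ _).finite_of_discrete
  apply (hfin.image (latPt A)).subset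
  rintro γ ⟨hγ, hr⟩
  rw [lat_eq] at hγ
  obtain ⟨n, rfl⟩ := hγ
  refine ⟨n, ?_, rfl⟩
  have h1 := hC _ ⟨latPt A n, by simpa using hr, rfl⟩
  have h2 : f (latPt A n) = fun j => (n j : ℝ) := by
    simp [f, latPt, Matrix.mulVec_mulVec, Matrix.nonsing_inv_mul A hu]
  rw [h2] at h1
  have hC0 : 0 ≤ C := (norm_nonneg _).trans h1
  rw [mem_closedBall_zero_iff, pi_norm_le_iff_of_nonneg hC0]
  intro j
  have := (pi_norm_le_iff_of_nonneg hC0).1 h1 j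
  simpa [Int.norm_eq_abs] using this

open scoped Pointwise in
/-- Counting in `ℤ^d`. -/
lemma vol_le_of_count_pi {d : ℕ} (S : Set (Fin d → ℝ)) (hS : MeasurableSet S) (N : ℕ∞)
    (h : ∀ x : Fin d → ℝ, {n : Fin d → ℤ | x + (fun j => (n j : ℝ)) ∈ S}.encard ≤ N) :
    volume S ≤ (N : ENNReal) := by
  let b := Pi.basisFun ℝ (Fin d)
  have hfd := ZSpan.isAddFundamentalDomain b (volume : Measure (Fin d → ℝ))
  have hinv : VAddInvariantMeasure (Submodule.span ℤ (Set.range b)) (Fin d → ℝ) volume :=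
    ⟨fun c s _ => measure_preimage_add volume (c : Fin d → ℝ) s⟩
  have hcv : MeasurableConstVAdd (Submodule.span ℤ (Set.range b)) (Fin d → ℝ) :=
    ⟨fun c => measurable_const_add (c : Fin d → ℝ)⟩
  rw [hfd.measure_eq_tsum S]
  have hvol : volume (ZSpan.fundamentalDomain b) = 1 := by
    rw [ZSpan.volume_fundamentalDomain]
    have : Matrix.of (⇑b) = (1 : Matrix (Fin d) (Fin d) ℝ) := by
      ext i j
      simp [b, Matrix.one_apply, Pi.single_apply, eq_comm]
    rw [this]; simp
  have hm : ∀ g : Submodule.span ℤ (Set.range b), MeasurableSet (g +ᵥ S) := fun g => hS.const_vadd g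
  have hcount : ∀ x : Fin d → ℝ, {g : Submodule.span ℤ (Set.range b) | x ∈ g +ᵥ S}.encard ≤ N := by
    intro x
    refine le_trans ?_ (h x)
    have hz : ∀ g : Submodule.span ℤ (Set.range b), ∃ n : Fin d → ℤ, (fun j => (n j : ℝ)) = -(g : Fin d → ℝ) := by
      intro g
      have hg := (b.mem_span_iff_repr_mem ℤ (g : Fin d → ℝ)).1 g.2
      choose n hn using hg
      refine ⟨fun j => - n j, ?_⟩
      ext j
      have := hn j
      simp [b] at this
      simp [this]
    choose φ hφ using hz
    have hinj : Function.Injective φ := by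
      intro g g' hgg
      have h1 := hφ g
      rw [hgg, hφ g'] at h1
      exact Subtype.ext (neg_injective h1.symm)
    rw [← hinj.encard_image]
    apply Set.encard_le_encard
    rintro _ ⟨g, hg, rfl⟩
    simp only [Set.mem_ofPred_eq] at hg ⊢
    rw [hφ g]
    rw [Set.mem_vadd_set_iff_neg_vadd_mem] at hg
    have : -g +ᵥ x = x + -(g : Fin d → ℝ) := by
      rw [add_comm]; rfl
    rwa [this] at hg
  calc ∑' g : Submodule.span ℤ (Set.range b), volume ((g +ᵥ S) ∩ ZSpan.fundamentalDomain b)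
      = ∑' g : Submodule.span ℤ (Set.range b), ∫⁻ x in ZSpan.fundamentalDomain b, (g +ᵥ S).indicator 1 x := by
        congr 1; ext g
        rw [lintegral_indicator_one (hm g), Measure.restrict_apply (hm g)]
    _ = ∫⁻ x in ZSpan.fundamentalDomain b, ∑' g : Submodule.span ℤ (Set.range b), (g +ᵥ S).indicator 1 x := by
        rw [lintegral_tsum]
        intro g
        exact (measurable_one.indicator (hm g)).aemeasurable
    _ ≤ ∫⁻ x in ZSpan.fundamentalDomain b, (N : ENNReal) := by
        apply lintegral_mono
        intro x
        have : ∑' g : Submodule.span ℤ (Set.range b), (g +ᵥ S).indicator (1 : (Fin d → ℝ) → ENNReal) x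
          = ({g : Submodule.span ℤ (Set.range b) | x ∈ g +ᵥ S}.encard : ENNReal) := by
          rw [← ENNReal.tsum_set_one]
          refine Eq.trans ?_ (tsum_subtype {g : Submodule.span ℤ (Set.range b) | x ∈ g +ᵥ S}
            (fun _ => (1 : ENNReal))).symm
          rfl
        simp only [this]
        exact_mod_cast hcount x
    _ = N := by rw [lintegral_const, Measure.restrict_apply_univ, hvol, mul_one]

lemma vol_le_of_count {d : ℕ} (A : Matrix (Fin d) (Fin d) ℝ) (hA : |A.det| = 1)
    (S : Set (EuclideanSpace ℝ (Fin d))) (hS : MeasurableSet S) (N : ℕ∞)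
    (h : ∀ x, {n : Fin d → ℤ | x + latPt A n ∈ S}.encard ≤ N) :
    volume S ≤ (N : ENNReal) := by
  have hA0 : A.det ≠ 0 := by intro h0; simp [h0] at hA
  have hdet : LinearMap.det (Matrix.toLin' A) ≠ 0 := by rwa [LinearMap.det_toLin']
  let S1 : Set (Fin d → ℝ) := WithLp.toLp 2 ⁻¹' S
  have hS1 : MeasurableSet S1 := (PiLp.volume_preserving_toLp (Fin d)).measurable hS
  have e1 : volume S1 = volume S :=
    (PiLp.volume_preserving_toLp (Fin d)).measure_preimage hS.nullMeasurableSet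
  have e2 : volume (Matrix.toLin' A ⁻¹' S1) = volume S1 := by
    rw [Measure.addHaar_preimage_linearMap volume hdet, LinearMap.det_toLin', abs_inv, hA]
    simp
  rw [← e1, ← e2]
  apply vol_le_of_count_pi
  · exact (LinearMap.continuous_of_finiteDimensional (Matrix.toLin' A)).measurable hS1
  · intro x
    convert! h (WithLp.toLp 2 (A.mulVec x)) using 3 with n
    simp [S1, latPt, Matrix.mulVec_add]

lemma infDist_lat_add {d : ℕ} (A : Matrix (Fin d) (Fin d) ℝ) (y : EuclideanSpace ℝ (Fin d))
    (n : Fin d → ℤ) :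
    Metric.infDist (y - latPt A n) (lat d A) ≤ Metric.infDist y (lat d A) := by
  have hne : (lat d A).Nonempty := ⟨0, by rw [lat_eq]; exact ⟨0, latPt_zero A⟩⟩
  apply le_of_forall_gt
  intro r hr
  obtain ⟨z, hz, hzr⟩ := (Metric.infDist_lt_iff hne).1 hr
  rw [lat_eq] at hz
  obtain ⟨m, rfl⟩ := hz
  apply (Metric.infDist_lt_iff hne).2
  refine ⟨latPt A (m - n), by rw [lat_eq]; exact ⟨_, rfl⟩, ?_⟩
  rw [latPt_sub]
  simpa using hzr

lemma covering (d : ℕ) (δ : ℝ) (hδ : 0 < δ) :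
    ∃ R : ℝ, 0 ≤ R ∧ ∀ A : Matrix (Fin d) (Fin d) ℝ, |A.det| = 1 →
      (∀ n : Fin d → ℤ, n ≠ 0 → δ ≤ ‖latPt A n‖) →
      ∀ x : EuclideanSpace ℝ (Fin d), ∃ n : Fin d → ℤ, ‖x + latPt A n‖ ≤ R := by
  let v := volume (Metric.ball (0 : EuclideanSpace ℝ (Fin d)) (δ/2))
  have hv : v ≠ 0 := (Metric.measure_ball_pos volume _ (by positivity)).ne'
  obtain ⟨M, hM⟩ := ENNReal.exists_nat_mul_gt (a := v) (b := 1) hv (by simp)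
  refine ⟨M * δ + 1, by positivity, ?_⟩
  intro A hA hmin x
  by_contra hcon
  push Not at hcon
  have hne : (lat d A).Nonempty := ⟨0, by rw [lat_eq]; exact ⟨0, latPt_zero A⟩⟩
  let f : EuclideanSpace ℝ (Fin d) → ℝ := fun y => Metric.infDist y (lat d A)
  have hf0 : f 0 = 0 := by
    apply Metric.infDist_zero_of_mem
    rw [lat_eq]; exact ⟨0, latPt_zero A⟩
  have hfx : M * δ ≤ f x := by
    apply (Metric.le_infDist hne).2
    intro y hy
    rw [lat_eq] at hy
    obtain ⟨n, rfl⟩ := hy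
    have := hcon (0 - n)
    rw [latPt_sub, latPt_zero] at this
    rw [dist_eq_norm]
    have h2 : x + (0 - latPt A n) = x - latPt A n := by abel
    rw [h2] at this
    linarith
  have hcont : Continuous (fun t : ℝ => f (t • x)) :=
    (Metric.continuous_infDist_pt _).comp (by fun_prop)
  have hy : ∀ j : Fin M, ∃ y, f y = j * δ := by
    intro j
    have := intermediate_value_Icc (zero_le_one' ℝ) hcont.continuousOn
    have hmem : (j : ℝ) * δ ∈ Set.Icc (f ((0:ℝ) • x)) (f ((1:ℝ) • x)) := by
      rw [zero_smul, one_smul, hf0]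
      refine ⟨by positivity, le_trans ?_ hfx⟩
      gcongr
      exact_mod_cast j.2.le
    obtain ⟨t, _, ht⟩ := this hmem
    exact ⟨_, ht⟩
  choose y hy using hy
  -- key separation
  have half : ∀ (i j : Fin M) (n m : Fin d → ℤ) (z : EuclideanSpace ℝ (Fin d)),
      z + latPt A n ∈ Metric.ball (y i) (δ/2) → z + latPt A m ∈ Metric.ball (y j) (δ/2) →
      (i : ℝ) * δ < j * δ + δ := by
    intro i j n m z h1 h2
    rw [← hy i, ← hy j]
    have a1 : f (y i) ≤ f (y i - latPt A (n - m)) := by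
      have := infDist_lat_add A (y i - latPt A (n - m)) (m - n)
      have e : y i - latPt A (n - m) - latPt A (m - n) = y i := by
        rw [latPt_sub, latPt_sub]; abel
      rw [e] at this
      exact this
    have a2 : f (y i - latPt A (n - m)) ≤ f (y j) + dist (y i - latPt A (n - m)) (y j) :=
      Metric.infDist_le_infDist_add_dist
    have a3 : dist (y i - latPt A (n - m)) (y j) < δ := by
      rw [Metric.mem_ball] at h1 h2
      rw [dist_comm] at h1
      have t := dist_triangle (y i - latPt A (n - m)) (z + latPt A m) (y j)
      have e : dist (y i - latPt A (n - m)) (z + latPt A m) = dist (y i) (z + latPt A n) := by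
        rw [dist_eq_norm, dist_eq_norm, latPt_sub]; congr 1; abel
      linarith
    linarith
  have key : ∀ (i j : Fin M) (n m : Fin d → ℤ) (z : EuclideanSpace ℝ (Fin d)),
      z + latPt A n ∈ Metric.ball (y i) (δ/2) → z + latPt A m ∈ Metric.ball (y j) (δ/2) →
      i = j := by
    intro i j n m z h1 h2
    have b1 := half i j n m z h1 h2
    have b2 := half j i m n z h2 h1
    have c1 : (i : ℝ) < j + 1 := by nlinarith
    have c2 : (j : ℝ) < i + 1 := by nlinarith
    have c1' : (i : ℕ) < j + 1 := by exact_mod_cast c1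
    have c2' : (j : ℕ) < i + 1 := by exact_mod_cast c2
    ext; omega
  have hle := vol_le_of_count A hA (⋃ i : Fin M, Metric.ball (y i) (δ/2))
    (MeasurableSet.iUnion fun i => measurableSet_ball) 1 (by
      intro z
      rw [Set.encard_le_one_iff]
      intro n m hn hm
      simp only [Set.mem_ofPred_eq, Set.mem_iUnion] at hn hm
      obtain ⟨i, hi⟩ := hn
      obtain ⟨j, hj⟩ := hm
      have hij := key i j n m z hi hj
      subst hij
      by_contra hnm
      have h1 := hmin (n - m) (sub_ne_zero.2 hnm)
      rw [Metric.mem_ball] at hi hj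
      have t := dist_triangle_right (z + latPt A n) (z + latPt A m) (y i)
      have e : dist (z + latPt A n) (z + latPt A m) = ‖latPt A (n - m)‖ := by
        rw [dist_eq_norm, latPt_sub]; congr 1; abel
      linarith)
  rw [measure_iUnion (by
      intro i j hij
      rw [Function.onFun, Set.disjoint_left]
      intro z hi hj
      apply hij
      apply key i j 0 0 z <;> simpa [latPt_zero] using ‹_›) (fun i => measurableSet_ball)] at hle
  have hvv : ∀ i, volume (Metric.ball (y i) (δ/2)) = v := fun i =>
    Measure.addHaar_ball_center volume (y i) (δ/2)
  simp only [hvv, tsum_fintype, Finset.sum_const, Finset.card_univ, Fintype.card_fin, nsmul_eq_mul] at hle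
  exact absurd hle (not_le.2 (by simpa using hM))

lemma gammaNorm_le (d : ℕ) (A : Matrix (Fin d) (Fin d) ℝ) (hA : |A.det| = 1) (R : ℝ) (hR0 : 0 ≤ R)
    (hR : ∀ x : EuclideanSpace ℝ (Fin d), ∃ n : Fin d → ℤ, ‖x + latPt A n‖ ≤ R)
    (s : ℝ) (hs : 0 ≤ s) (k : ℕ)
    (hk : (k : ENNReal) < volume (Metric.ball (0 : EuclideanSpace ℝ (Fin d)) s)) :
    gammaNorm d A k ≤ s + R := by
  have hA0 : A.det ≠ 0 := by intro h0; simp [h0] at hA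
  apply csInf_le ⟨0, fun r hr => hr.1⟩
  refine ⟨by positivity, ?_⟩
  have hfin := lat_finite A hA0 (s + R)
  have hle := vol_le_of_count A hA (Metric.ball 0 s) measurableSet_ball
    ({γ ∈ lat d A | ‖γ‖ ≤ s + R}).encard (by
      intro x
      obtain ⟨m, hm⟩ := hR x
      have hinj : Function.Injective (fun n => latPt A (n - m)) := by
        intro n n' h
        have := latPt_inj A hA0 h
        simpa using this
      rw [← hinj.encard_image]
      apply Set.encard_le_encard
      rintro _ ⟨n, hn, rfl⟩
      refine ⟨by rw [lat_eq]; exact ⟨_, rfl⟩, ?_⟩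
      simp only [Set.mem_ofPred_eq, mem_ball_zero_iff] at hn
      have e : latPt A (n - m) = (x + latPt A n) - (x + latPt A m) := by
        rw [latPt_sub]; abel
      simp only [e]
      refine (norm_sub_le _ _).trans ?_
      linarith)
  rw [← hfin.cast_ncard_eq] at hle
  have := hk.trans_le hle
  have h2 : k < ({γ ∈ lat d A | ‖γ‖ ≤ s + R}).ncard := by
    simpa using this
  exact h2

lemma le_norm_of_mu (d : ℕ) (A : Matrix (Fin d) (Fin d) ℝ) (hA : A.det ≠ 0) (δ : ℝ)
    (h : δ ≤ mu d A 1) (n : Fin d → ℤ) (hn : n ≠ 0) : δ ≤ ‖latPt A n‖ := by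
  have hne : latPt A n ≠ 0 := by
    rw [← latPt_zero A]
    exact fun h => hn (latPt_inj A hA h)
  refine h.trans (csInf_le ⟨0, fun r hr => hr.1.le⟩ ⟨norm_pos_iff.2 hne, ?_⟩)
  rw [Nat.one_le_iff_ne_zero]
  intro h0
  have h1 := Submodule.finrank_eq_zero.1 h0
  have : latPt A n ∈ Submodule.span ℝ {γ ∈ lat d A | ‖γ‖ ≤ ‖latPt A n‖} :=
    Submodule.subset_span ⟨by rw [lat_eq]; exact ⟨n, rfl⟩, le_rfl⟩
  rw [h1] at this
  exact hne (by simpa using this)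

/-- The degenerating comparison lattice. -/
lemma Lam_lower (d : ℕ) (hd : 2 ≤ d) (k : ℕ) (hk : 1 ≤ k) :
    ∃ B : Matrix (Fin d) (Fin d) ℝ, B.det ≠ 0 ∧ ((k : ℝ) / 2) ^ ((1 : ℝ) / d) ≤ Lam d B k := by
  have hk0 : (0 : ℝ) < k := by exact_mod_cast hk
  let i0 : Fin d := ⟨0, by omega⟩
  let D : Fin d → ℝ := fun i => if i = i0 then 2 / k else 1
  let B := Matrix.diagonal D
  have hdet : B.det = 2 / k := by
    simp [B, D, Matrix.det_diagonal]
  have hdet0 : B.det ≠ 0 := by rw [hdet]; positivity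
  have hpt : ∀ n i, latPt B n i = D i * n i := by
    intro n i
    simp [latPt, B, Matrix.mulVec_diagonal]
  refine ⟨B, hdet0, ?_⟩
  have hg : 1 ≤ gammaNorm d B k := by
    apply le_csInf
    · -- nonempty
      let p : Fin (k+1) → EuclideanSpace ℝ (Fin d) := fun j => latPt B (fun i => (j : ℤ))
      have hp : Function.Injective p := by
        intro j j' h
        have := congrFun (latPt_inj B hdet0 h) i0
        ext
        exact_mod_cast this
      obtain ⟨C, hC⟩ := (Set.finite_range p).isBounded.exists_norm_le
      have hC0 : 0 ≤ C := (norm_nonneg _).trans (hC (p 0) ⟨0, rfl⟩)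
      refine ⟨C, hC0, ?_⟩
      have h1 : (Set.range p).ncard = k + 1 := by
        rw [← Set.image_univ, Set.ncard_image_of_injective _ hp, Set.ncard_univ]; simp
      rw [← h1]
      apply Set.ncard_le_ncard _ (lat_finite B hdet0 C)
      rintro _ ⟨j, rfl⟩
      exact ⟨by rw [lat_eq]; exact ⟨_, rfl⟩, hC _ ⟨j, rfl⟩⟩
    · rintro r ⟨hr0, hr⟩
      by_contra hlt
      push Not at hlt
      let T : Finset ℤ := Finset.Icc (-(((k:ℤ) - 1) / 2)) (((k:ℤ) - 1) / 2)
      have hT : T.card ≤ k := by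
        simp only [T, Int.card_Icc]; omega
      have hsub : {γ ∈ lat d B | ‖γ‖ ≤ r} ⊆
          (fun j : ℤ => latPt B (fun i => if i = i0 then j else 0)) '' (T : Set ℤ) := by
        rintro γ ⟨hγ, hn⟩
        rw [lat_eq] at hγ
        obtain ⟨n, rfl⟩ := hγ
        have hcoord : ∀ i, |D i * n i| < 1 := by
          intro i
          have := PiLp.norm_apply_le (latPt B n) i
          rw [hpt, Real.norm_eq_abs] at this
          linarith
        refine ⟨n i0, ?_, ?_⟩
        · have h1 := hcoord i0
          simp only [D, if_true] at h1
          rw [abs_lt] at h1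
          have e : (2 / (k:ℝ)) * n i0 = 2 * n i0 / k := by ring
          rw [e, div_lt_one hk0, lt_div_iff₀ hk0] at h1
          have h2 : -1 * (k : ℤ) < 2 * n i0 := by exact_mod_cast h1.1
          have h3 : 2 * n i0 < (k : ℤ) := by exact_mod_cast h1.2
          simp only [T, Finset.coe_Icc, Set.mem_Icc]
          omega
        · simp only
          congr 1
          ext i
          by_cases hi : i = i0
          · simp [hi]
          · have h1 := hcoord i
            simp only [D, if_neg hi, one_mul] at h1
            have h2 : |n i| < 1 := by exact_mod_cast h1
            rw [if_neg hi]
            exact (Int.abs_lt_one_iff.1 h2).symm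
      have hle := Set.ncard_le_ncard hsub (T.finite_toSet.image _)
      have hle2 := Set.ncard_image_le (f := fun j : ℤ => latPt B (fun i => if i = i0 then j else 0)) T.finite_toSet
      rw [Set.ncard_coe_finset] at hle2
      omega
  unfold Lam
  have e : |B.det| ^ (-(1:ℝ) / d) = ((k : ℝ) / 2) ^ ((1 : ℝ) / d) := by
    rw [hdet, abs_of_pos (by positivity), neg_div, Real.rpow_neg (by positivity),
      ← Real.inv_rpow (by positivity), inv_div]
  rw [e]
  exact le_mul_of_one_le_right (by positivity) hg

/-- For `2 ≤ d ≤ 10`, if `Γ_k` is, for each `k ≥ 1`, a unit-covolume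
lattice maximising `Λ̃_k`, then `μ_1(Γ_k) → 0` as `k → ∞`; hence the sequence leaves
every set of unit-covolume lattices on which `μ_1` is bounded away from `0`
(no accumulation point, by Mahler's selection theorem). -/
theorem stmt_3 (d : ℕ) (hd2 : 2 ≤ d) (hd10 : d ≤ 10)
    (Γ : ℕ → Matrix (Fin d) (Fin d) ℝ)
    (hdet : ∀ k, 1 ≤ k → |(Γ k).det| = 1)
    (hmax : ∀ k, 1 ≤ k → ∀ B : Matrix (Fin d) (Fin d) ℝ, B.det ≠ 0 →
      Lam d B k ≤ Lam d (Γ k) k) :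
    Filter.Tendsto (fun k => mu d (Γ k) 1) Filter.atTop (nhds 0) := by
  have hd0 : (0:ℝ) < d := by exact_mod_cast (by omega : 0 < d)
  rw [Metric.tendsto_atTop]
  intro δ hδ
  obtain ⟨R, hR0, hR⟩ := covering d δ hδ
  have hc : ((2/5 : ℝ)) ^ ((1:ℝ)/d) < ((1/2 : ℝ)) ^ ((1:ℝ)/d) :=
    Real.rpow_lt_rpow (by norm_num) (by norm_num) (by positivity)
  have hlim : Filter.Tendsto (fun k : ℕ => (k : ℝ) ^ ((1:ℝ)/d) *
      (((1/2 : ℝ)) ^ ((1:ℝ)/d) - ((2/5 : ℝ)) ^ ((1:ℝ)/d))) Filter.atTop Filter.atTop := by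
    apply Filter.Tendsto.atTop_mul_const (by linarith)
    exact (tendsto_rpow_atTop (by positivity)).comp tendsto_natCast_atTop_atTop
  obtain ⟨K, hK⟩ := Filter.eventually_atTop.1 (hlim.eventually_gt_atTop R)
  refine ⟨max K 1, fun k hk => ?_⟩
  have hk1 : 1 ≤ k := le_trans (le_max_right _ _) hk
  have hkK : K ≤ k := le_trans (le_max_left _ _) hk
  have hk0 : (0:ℝ) < k := by exact_mod_cast hk1
  have hmu0 : 0 ≤ mu d (Γ k) 1 := Real.sInf_nonneg fun r hr => hr.1.le
  rw [Real.dist_eq, sub_zero, abs_of_nonneg hmu0]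
  by_contra hcon
  push Not at hcon
  have hA := hdet k hk1
  have hA0 : (Γ k).det ≠ 0 := by intro h0; simp [h0] at hA
  have hcov := hR (Γ k) hA (le_norm_of_mu d (Γ k) hA0 δ hcon)
  set s : ℝ := ((k:ℝ) * (2/5)) ^ ((1:ℝ)/d) with hs
  have hs0 : 0 < s := by positivity
  have hsd : 5/2 * s ^ d = k := by
    rw [hs, ← Real.rpow_natCast, ← Real.rpow_mul (by positivity), one_div,
      inv_mul_cancel₀ hd0.ne', Real.rpow_one]
    ring
  have hvol := vol_gt d hd2 hd10 s hs0
  rw [hsd, ENNReal.ofReal_natCast] at hvol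
  have hup := gammaNorm_le d (Γ k) hA R hR0 hcov s hs0.le k hvol
  obtain ⟨B, hB, hlow⟩ := Lam_lower d hd2 k hk1
  have hm := hmax k hk1 B hB
  have hLam : Lam d (Γ k) k = gammaNorm d (Γ k) k := by
    rw [Lam, hA, Real.one_rpow, one_mul]
  have hfin := hK k hkK
  have e1 : s = (k:ℝ) ^ ((1:ℝ)/d) * (2/5 : ℝ) ^ ((1:ℝ)/d) := by
    rw [hs, Real.mul_rpow (by positivity) (by positivity)]
  have e2 : ((k:ℝ)/2) ^ ((1:ℝ)/d) = (k:ℝ) ^ ((1:ℝ)/d) * (1/2 : ℝ) ^ ((1:ℝ)/d) := by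
    rw [← Real.mul_rpow (by positivity) (by positivity)]
    congr 1
    ring
  rw [mul_sub, ← e1, ← e2] at hfin
  linarith
end
end
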